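/- arXiv:1009.2990 — 2 statements merged into one kernel-verified Lean document; each statement's English description precedes it below -/
import Mathlib

section
/- For every N ≥ 1: if N is odd then Cov_{μ_N}(b, (a−b)²) = N(N−1)/16, and if N is even then Cov_{μ_N}(a, (a−b)²) = N(N−1)/16. -/
/-- The image of the delta measure at `p` under the Demazure operator `D₀`, acting in the
coordinates `λ = Λ₀ - a·α₀ - b·α₁`: `D₀ δ_{(a,b)} = ∑_{i=0}^{1-2a+2b} δ_{(a+i,b)}`, with the
signed-sum convention `∑_{i=0}^{-1} = 0` and `∑_{i=0}^{n} = -∑_{i=n+1}^{-1}` for `n ≤ -2`. -/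
noncomputable def elemD0 (p : ℤ × ℤ) : (ℤ × ℤ) →₀ ℤ :=
  (∑ i ∈ Finset.Icc (0 : ℤ) (1 - 2 * p.1 + 2 * p.2), Finsupp.single (p.1 + i, p.2) (1 : ℤ))
  - (∑ i ∈ Finset.Icc (1 - 2 * p.1 + 2 * p.2 + 1) (-1 : ℤ), Finsupp.single (p.1 + i, p.2) (1 : ℤ))

/-- The image of the delta measure at `p` under the Demazure operator `D₁`:
`D₁ δ_{(a,b)} = ∑_{i=0}^{2a-2b} δ_{(a,b+i)}`, with the signed-sum convention. -/
noncomputable def elemD1 (p : ℤ × ℤ) : (ℤ × ℤ) →₀ ℤ :=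
  (∑ i ∈ Finset.Icc (0 : ℤ) (2 * p.1 - 2 * p.2), Finsupp.single (p.1, p.2 + i) (1 : ℤ))
  - (∑ i ∈ Finset.Icc (2 * p.1 - 2 * p.2 + 1) (-1 : ℤ), Finsupp.single (p.1, p.2 + i) (1 : ℤ))

/-- The Demazure operator `D₀` on finitely supported functions `ℤ × ℤ → ℤ`. -/
noncomputable def demD0 (mu : (ℤ × ℤ) →₀ ℤ) : (ℤ × ℤ) →₀ ℤ :=
  mu.sum fun p c => c • elemD0 p

/-- The Demazure operator `D₁` on finitely supported functions `ℤ × ℤ → ℤ`. -/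
noncomputable def demD1 (mu : (ℤ × ℤ) →₀ ℤ) : (ℤ × ℤ) →₀ ℤ :=
  mu.sum fun p c => c • elemD1 p

/-- The weight distribution `μ_N` of the Demazure module `V_{w_N}(Λ₀)` of affine sl₂,
where a weight is written `λ = Λ₀ - a·α₀ - b·α₁`:  `μ₀ = δ_{(0,0)}`,
`μ_{N+1} = D₀ μ_N` for even `N` and `μ_{N+1} = D₁ μ_N` for odd `N`. -/
noncomputable def demMu : ℕ → (ℤ × ℤ) →₀ ℤ
  | 0 => Finsupp.single (0, 0) 1
  | (N + 1) => if Even N then demD0 (demMu N) else demD1 (demMu N)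

/-- Total mass `∑_{(a,b)} μ(a,b)` of a finitely supported signed measure, in `ℚ`. -/
noncomputable def totalMass (mu : (ℤ × ℤ) →₀ ℤ) : ℚ :=
  mu.sum fun _ c => (c : ℚ)

/-- Expected value of `f` with respect to `μ`. -/
noncomputable def expVal (mu : (ℤ × ℤ) →₀ ℤ) (f : ℤ × ℤ → ℚ) : ℚ :=
  (mu.sum fun p c => (c : ℚ) * f p) / totalMass mu

/-- Covariance of `f` and `g` with respect to `μ`. -/
noncomputable def covar (mu : (ℤ × ℤ) →₀ ℤ) (f g : ℤ × ℤ → ℚ) : ℚ :=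
  expVal mu (fun p => f p * g p) - expVal mu f * expVal mu g

/-- Variance of `f` with respect to `μ`. -/
noncomputable def var (mu : (ℤ × ℤ) →₀ ℤ) (f : ℤ × ℤ → ℚ) : ℚ :=
  covar mu f f

theorem signed_sum_Icc_telescope (G : ℤ → ℚ) (n : ℤ) :
    (∑ i ∈ Finset.Icc 0 n, (G (i + 1) - G i)) -
      ∑ i ∈ Finset.Icc (n + 1) (-1), (G (i + 1) - G i) = G (n + 1) - G 0 := by
  have hpos (k : ℕ) : ∑ i ∈ Finset.Icc (0 : ℤ) (k - 1), (G (i + 1) - G i) = G k - G 0 := by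
    induction k with
    | zero => simp
    | succ k ih =>
      have h : Finset.Icc (0 : ℤ) ((k + 1 : ℕ) - 1) = insert (k : ℤ) (Finset.Icc 0 ((k : ℤ) - 1))
        := by
        ext; simp only [Finset.mem_Icc, Finset.mem_insert]; omega
      rw [h, Finset.sum_insert (by simp), ih]
      push_cast
      ring
  have hneg (k : ℕ) : ∑ i ∈ Finset.Icc (-k : ℤ) (-1), (G (i + 1) - G i) = G 0 - G (-k) := by
    induction k with
    | zero => simp
    | succ k ih =>
      have h : Finset.Icc (-(k + 1 : ℕ) : ℤ) (-1) =
          insert (-(k + 1 : ℕ) : ℤ) (Finset.Icc (-(k : ℤ)) (-1)) := by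
        ext; simp only [Finset.mem_Icc, Finset.mem_insert]; omega
      rw [h, Finset.sum_insert (by simp), ih]
      have h' : -((k + 1 : ℕ) : ℤ) + 1 = -k := by push_cast; ring
      rw [h']
      ring
  obtain ⟨k, hk | hk⟩ := (n + 1).eq_nat_or_neg
  · rw [show n = k - 1 by omega, hpos, Finset.Icc_eq_empty (by omega)]
    simp
  · rw [hk, hneg, Finset.Icc_eq_empty (by omega)]
    simp

/-- Integration of rational-valued functions against a finitely supported signed measure. -/
noncomputable def pairing (mu : (ℤ × ℤ) →₀ ℤ) : (ℤ × ℤ → ℚ) →ₗ[ℚ] ℚ where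
  toFun f := mu.sum fun p c => (c : ℚ) * f p
  map_add' f g := by simp [mul_add, Finsupp.sum_add]
  map_smul' r f := by simp [Finsupp.mul_sum, mul_left_comm]

theorem pairing_apply (mu : (ℤ × ℤ) →₀ ℤ) (f : ℤ × ℤ → ℚ) :
    pairing mu f = mu.sum fun p c => (c : ℚ) * f p := rfl

theorem pairing_eq_lift (mu : (ℤ × ℤ) →₀ ℤ) (f : ℤ × ℤ → ℚ) :
    pairing mu f = Finsupp.liftAddHom (fun p => (AddMonoidHom.mulRight (f p)).comp
      (Int.castAddHom ℚ)) mu := by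
  simp [pairing_apply, Function.comp_def]

theorem pairing_single (p : ℤ × ℤ) (f : ℤ × ℤ → ℚ) :
    pairing (Finsupp.single p 1) f = f p := by
  simp [pairing_apply]

theorem pairing_sum_smul (mu : (ℤ × ℤ) →₀ ℤ) (F : ℤ × ℤ → (ℤ × ℤ) →₀ ℤ) (f : ℤ × ℤ → ℚ) :
    pairing (mu.sum fun p c => c • F p) f = pairing mu fun p => pairing (F p) f := by
  rw [pairing_eq_lift, pairing_apply, map_finsuppSum]
  simp only [map_zsmul, ← pairing_eq_lift, zsmul_eq_mul]

theorem pairing_elemD0 (p : ℤ × ℤ) (f : ℤ × ℤ → ℚ) (G : ℤ → ℚ)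
    (hG : ∀ i, f (p.1 + i, p.2) = G (i + 1) - G i) :
    pairing (elemD0 p) f = G (2 - 2 * p.1 + 2 * p.2) - G 0 := by
  rw [elemD0, pairing_eq_lift, map_sub, map_sum, map_sum]
  simp only [← pairing_eq_lift, pairing_single, hG]
  rw [signed_sum_Icc_telescope]
  ring_nf

theorem pairing_elemD1 (p : ℤ × ℤ) (f : ℤ × ℤ → ℚ) (G : ℤ → ℚ)
    (hG : ∀ i, f (p.1, p.2 + i) = G (i + 1) - G i) :
    pairing (elemD1 p) f = G (2 * p.1 - 2 * p.2 + 1) - G 0 := by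
  rw [elemD1, pairing_eq_lift, map_sub, map_sum, map_sum]
  simp only [← pairing_eq_lift, pairing_single, hG]
  rw [signed_sum_Icc_telescope]

/-- One Demazure step, for a functional `L` and coordinates `c`, `u`: the new functional `L'` fixes
`c' = c + u + ε` and sums over the string `u' = -u - 1/2, …, u + 1/2`, a sum which is expressed
through discrete antiderivatives. -/
def IsDemazureStep (L L' : (ℤ × ℤ → ℚ) →ₗ[ℚ] ℚ) (c u c' u' : ℤ × ℤ → ℚ) (ε : ℚ) : Prop :=
  ∀ (j : ℕ) (g G : ℚ → ℚ), (∀ v, G (v + 1) - G v = g v) →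
    L' (fun p => c' p ^ j * g (u' p)) =
      L (fun p => (c p + u p + ε) ^ j * (G (u p + 3 / 2) - G (-u p - 1 / 2)))

theorem isDemazureStep_demD0 (mu : (ℤ × ℤ) →₀ ℤ) :
    IsDemazureStep (pairing mu) (pairing (demD0 mu)) (fun p => p.1) (fun p => p.2 - p.1)
      (fun p => p.2) (fun p => p.1 - p.2 - 1 / 2) 0 := by
  intro j g G hG
  rw [demD0, pairing_sum_smul]
  congr 1
  funext p
  rw [pairing_elemD0 p _ (fun i => (p.2 : ℚ) ^ j * G (p.1 + i - p.2 - 1 / 2))]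
  · push_cast
    ring_nf
  · intro i
    rw [← hG]
    push_cast
    ring_nf

theorem isDemazureStep_demD1 (mu : (ℤ × ℤ) →₀ ℤ) :
    IsDemazureStep (pairing mu) (pairing (demD1 mu)) (fun p => p.2) (fun p => p.1 - p.2 - 1 / 2)
      (fun p => p.1) (fun p => p.2 - p.1) (1 / 2) := by
  intro j g G hG
  rw [demD1, pairing_sum_smul]
  congr 1
  funext p
  rw [pairing_elemD1 p _ (fun i => (p.1 : ℚ) ^ j * G (p.2 + i - p.1))]
  · push_cast
    ring_nf
  · intro i
    rw [← hG]
    push_cast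
    ring_nf

/-- The low-order joint moments of the coordinates `c`, `u` for a functional of total mass `M`,
with mean `e` of `c`, after `n` Demazure steps. -/
structure HasDemazureMoments (L : (ℤ × ℤ → ℚ) →ₗ[ℚ] ℚ) (c u : ℤ × ℤ → ℚ) (n e M : ℚ) :
    Prop where
  one : L 1 = M
  u1 : L u = 0
  u2 : L (u ^ 2) = n / 4 * M
  u3 : L (u ^ 3) = 0
  u4 : L (u ^ 4) = (3 * n ^ 2 / 16 - n / 8) * M
  u5 : L (u ^ 5) = 0
  c0 : L c = e * M
  cu1 : L (c * u) = 0
  cu2 : L (c * u ^ 2) = (e * n / 4 + n * (n - 1) / 16) * M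
  cu3 : L (c * u ^ 3) = 0

theorem HasDemazureMoments.step {L L' : (ℤ × ℤ → ℚ) →ₗ[ℚ] ℚ} {c u c' u' : ℤ × ℤ → ℚ}
    {n e M ε : ℚ} (h : HasDemazureMoments L c u n e M) (hs : IsDemazureStep L L' c u c' u' ε) :
    HasDemazureMoments L' c' u' (n + 1) (e + n / 4 + ε) (2 * M) := by
  have one := hs 0 (fun v => v ^ 0) (fun v => v) (fun v => by ring)
  have u1 := hs 0 (fun v => v ^ 1) (fun v => (v ^ 2 - v) / 2) (fun v => by ring)
  have u2 := hs 0 (fun v => v ^ 2) (fun v => (v ^ 3 - 3 / 2 * v ^ 2 + v / 2) / 3) (fun v => by ring)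
  have u3 := hs 0 (fun v => v ^ 3) (fun v => (v ^ 4 - 2 * v ^ 3 + v ^ 2) / 4) (fun v => by ring)
  have u4 := hs 0 (fun v => v ^ 4) (fun v => (v ^ 5 - 5 / 2 * v ^ 4 + 5 / 3 * v ^ 3 - v / 6) / 5)
    (fun v => by ring)
  have u5 := hs 0 (fun v => v ^ 5) (fun v => (v ^ 6 - 3 * v ^ 5 + 5 / 2 * v ^ 4 - v ^ 2 / 2) / 6)
    (fun v => by ring)
  have c0 := hs 1 (fun v => v ^ 0) (fun v => v) (fun v => by ring)
  have cu1 := hs 1 (fun v => v ^ 1) (fun v => (v ^ 2 - v) / 2) (fun v => by ring)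
  have cu2 := hs 1 (fun v => v ^ 2) (fun v => (v ^ 3 - 3 / 2 * v ^ 2 + v / 2) / 3) (fun v => by
    ring)
  have cu3 := hs 1 (fun v => v ^ 3) (fun v => (v ^ 4 - 2 * v ^ 3 + v ^ 2) / 4) (fun v => by ring)
  constructor
  · refine Eq.trans ?_ (one.trans ?_)
    · congr 1; funext p; simp
    · trans L ((2 : ℚ) • u + (2 : ℚ) • 1)
      · congr 1; funext p
        simp only [Pi.add_apply, Pi.smul_apply, Pi.one_apply,
          smul_eq_mul]
        ring
      · simp only [map_add, map_smul, smul_eq_mul, h.u1, h.one]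
        ring
  · refine Eq.trans ?_ (u1.trans ?_)
    · congr 1; funext p; simp
    · convert map_zero L using 2; funext p; simp only [Pi.zero_apply]; ring
  · refine Eq.trans ?_ (u2.trans ?_)
    · congr 1; funext p; simp
    · trans L ((2 / 3 : ℚ) • (u ^ 3) + (2 : ℚ) • (u ^ 2) + (11 / 6 : ℚ) • u + (1 / 2 : ℚ) • 1)
      · congr 1; funext p
        simp only [Pi.add_apply, Pi.smul_apply, Pi.pow_apply, Pi.one_apply,
          smul_eq_mul]
        ring
      · simp only [map_add, map_smul, smul_eq_mul, h.u3, h.u2, h.u1, h.one]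
        ring
  · refine Eq.trans ?_ (u3.trans ?_)
    · congr 1; funext p; simp
    · convert map_zero L using 2; funext p; simp only [Pi.zero_apply]; ring
  · refine Eq.trans ?_ (u4.trans ?_)
    · congr 1; funext p; simp
    · trans L ((2 / 5 : ℚ) • (u ^ 5) + (2 : ℚ) • (u ^ 4) + (11 / 3 : ℚ) • (u ^ 3) + (3 : ℚ) • (u ^
          2) + (127 / 120 : ℚ) • u + (1 / 8 : ℚ) • 1)
      · congr 1; funext p
        simp only [Pi.add_apply, Pi.smul_apply, Pi.pow_apply, Pi.one_apply,
          smul_eq_mul]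
        ring
      · simp only [map_add, map_smul, smul_eq_mul, h.u5, h.u4, h.u3, h.u2, h.u1, h.one]
        ring
  · refine Eq.trans ?_ (u5.trans ?_)
    · congr 1; funext p; simp
    · convert map_zero L using 2; funext p; simp only [Pi.zero_apply]; ring
  · refine Eq.trans ?_ (c0.trans ?_)
    · congr 1; funext p; simp
    · trans L ((2 : ℚ) • (c * u) + (2 : ℚ) • c + (2 : ℚ) • (u ^ 2) + (2 * ε + 2 : ℚ) • u + (2 * ε
          : ℚ) • 1)
      · congr 1; funext p
        simp only [Pi.add_apply, Pi.smul_apply, Pi.mul_apply, Pi.pow_apply, Pi.one_apply,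
          smul_eq_mul]
        ring
      · simp only [map_add, map_smul, smul_eq_mul, h.cu1, h.c0, h.u2, h.u1, h.one]
        ring
  · refine Eq.trans ?_ (cu1.trans ?_)
    · congr 1; funext p; simp
    · convert map_zero L using 2; funext p; simp only [Pi.zero_apply]; ring
  · refine Eq.trans ?_ (cu2.trans ?_)
    · congr 1; funext p; simp
    · trans L ((2 / 3 : ℚ) • (c * u ^ 3) + (2 : ℚ) • (c * u ^ 2) + (11 / 6 : ℚ) • (c * u) + (1 / 2
          : ℚ) • c + (2 / 3 : ℚ) • (u ^ 4) + (2 / 3 * ε + 2 : ℚ) • (u ^ 3) + (2 * ε + 11 / 6 : ℚ)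
          • (u ^ 2) + (11 / 6 * ε + 1 / 2 : ℚ) • u + (1 / 2 * ε : ℚ) • 1)
      · congr 1; funext p
        simp only [Pi.add_apply, Pi.smul_apply, Pi.mul_apply, Pi.pow_apply, Pi.one_apply,
          smul_eq_mul]
        ring
      · simp only [map_add, map_smul, smul_eq_mul, h.cu3, h.cu2, h.cu1, h.c0, h.u4, h.u3, h.u2,
        h.u1, h.one]
        ring
  · refine Eq.trans ?_ (cu3.trans ?_)
    · congr 1; funext p; simp
    · convert map_zero L using 2; funext p; simp only [Pi.zero_apply]; ring

theorem HasDemazureMoments.covariance {mu : (ℤ × ℤ) →₀ ℤ} {c u : ℤ × ℤ → ℚ} {n e M : ℚ}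
    (h : HasDemazureMoments (pairing mu) c u n e M) (hM : M ≠ 0) (s : ℚ) :
    covar mu c (fun p => (u p + s) ^ 2) = n * (n - 1) / 16 := by
  have hmass : totalMass mu = M := by
    rw [← h.one, pairing_apply]
    simp [totalMass]
  have hsq : pairing mu (fun p => (u p + s) ^ 2) = (n / 4 + s ^ 2) * M := by
    trans pairing mu (u ^ 2 + (2 * s) • u + s ^ 2 • 1)
    · congr 1
      funext p
      simp only [Pi.add_apply, Pi.smul_apply, Pi.pow_apply, Pi.one_apply, smul_eq_mul]
      ring
    · simp only [map_add, map_smul, smul_eq_mul, h.u2, h.u1, h.one]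
      ring
  have hmul : pairing mu (fun p => c p * (u p + s) ^ 2) =
      (e * n / 4 + n * (n - 1) / 16 + s ^ 2 * e) * M := by
    trans pairing mu (c * u ^ 2 + (2 * s) • (c * u) + s ^ 2 • c)
    · congr 1
      funext p
      simp only [Pi.add_apply, Pi.smul_apply, Pi.mul_apply, Pi.pow_apply, smul_eq_mul]
      ring
    · simp only [map_add, map_smul, smul_eq_mul, h.cu2, h.cu1, h.c0]
      ring
  simp only [covar, expVal, hmass, ← pairing_apply, hsq, hmul, h.c0]
  field_simp
  ring

theorem hasDemazureMoments_demMu (N : ℕ) :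
    ∃ e : ℚ,
      (Even N → HasDemazureMoments (pairing (demMu N)) (fun p => p.1) (fun p => p.2 - p.1)
        N e (2 ^ N)) ∧
      (Odd N → HasDemazureMoments (pairing (demMu N)) (fun p => p.2)
        (fun p => p.1 - p.2 - 1 / 2) N e (2 ^ N)) := by
  induction N with
  | zero =>
    refine ⟨0, fun _ => ?_, fun h => by simp at h⟩
    constructor <;> simp [demMu, pairing_single]
  | succ N ih =>
    obtain ⟨e, heven, hodd⟩ := ih
    rcases Nat.even_or_odd N with hN | hN
    · refine ⟨e + N / 4 + 0, fun h => absurd h (Nat.not_even_iff_odd.mpr hN.add_one), fun _ => ?_⟩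
      rw [demMu, if_pos hN, pow_succ', Nat.cast_succ]
      exact (heven hN).step (isDemazureStep_demD0 _)
    · have hN' : ¬Even N := Nat.not_even_iff_odd.mpr hN
      refine ⟨e + N / 4 + 1 / 2, fun _ => ?_, fun h => absurd h (Nat.not_odd_iff_even.mpr
        hN.add_one)⟩
      rw [demMu, if_neg hN', pow_succ', Nat.cast_succ]
      exact (hodd hN).step (isDemazureStep_demD1 _)

/-- For `N ≥ 1`: if `N` is odd then `Cov_{μ_N}(b, (a-b)²) = N(N-1)/16`, and
if `N` is even then `Cov_{μ_N}(a, (a-b)²) = N(N-1)/16`. -/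
theorem covariance_with_finite_weight_sq (N : ℕ) (hN : 1 ≤ N) :
    (Odd N →
      covar (demMu N) (fun p => (p.2 : ℚ)) (fun p => ((p.1 : ℚ) - (p.2 : ℚ)) ^ 2) =
        (N : ℚ) * ((N : ℚ) - 1) / 16) ∧
    (Even N →
      covar (demMu N) (fun p => (p.1 : ℚ)) (fun p => ((p.1 : ℚ) - (p.2 : ℚ)) ^ 2) =
        (N : ℚ) * ((N : ℚ) - 1) / 16) := by
  obtain ⟨e, heven, hodd⟩ := hasDemazureMoments_demMu N
  have hM : (2 : ℚ) ^ N ≠ 0 := by positivity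
  constructor
  · intro h
    rw [← (hodd h).covariance hM (1 / 2)]
    congr 1
    funext p
    ring
  · intro h
    rw [← (heven h).covariance hM 0]
    congr 1
    funext p
    ring
end

section
/- (Modified recurrence relations.) For every odd N ≥ 1: E_{μ_{N+1}}[a²] = E_{μ_N}[b²] + N(N+2)(N+3)/16. For every even N ≥ 0: E_{μ_{N+1}}[b²] = E_{μ_N}[a²] + N(N+1)(N+2)/16. -/
/-- The number of binary words of length `N` with `k` ones and `d` inversions, as a function of
`(k, d)`: the coefficients of the Gaussian binomials. -/
noncomputable def wordCount : ℕ → (ℤ × ℤ) →₀ ℤ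
  | 0 => Finsupp.single (0, 0) 1
  | (N + 1) =>
      Finsupp.equivMapDomain ((Equiv.addRight (1 : ℤ)).prodCongr (Equiv.refl ℤ)) (wordCount N)
      + Finsupp.equivMapDomain (Equiv.prodShear (Equiv.refl ℤ) fun k => Equiv.addRight k)
          (wordCount N)

theorem wordCount_zero_apply (k d : ℤ) :
    wordCount 0 (k, d) = if k = 0 ∧ d = 0 then 1 else 0 := by
  simp only [wordCount, Finsupp.single_apply, Prod.mk.injEq, eq_comm]

/-- The first Pascal recursion. -/
theorem wordCount_succ_apply (N : ℕ) (k d : ℤ) :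
    wordCount (N + 1) (k, d) = wordCount N (k - 1, d) + wordCount N (k, d - k) := by
  simp [wordCount, Finsupp.equivMapDomain_apply, Equiv.prodShear, sub_eq_add_neg]

/-- The second Pascal recursion. -/
theorem wordCount_succ_apply' (N : ℕ) (k d : ℤ) :
    wordCount (N + 1) (k, d) =
      wordCount N (k, d) + wordCount N (k - 1, d - (N + 1 - k)) := by
  induction N generalizing k d with
  | zero =>
    simp only [wordCount_succ_apply, wordCount_zero_apply]
    split_ifs <;> simp_all <;> omega
  | succ N ih =>
    rw [wordCount_succ_apply, ih (k - 1), ih k, wordCount_succ_apply N k d,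
      wordCount_succ_apply N (k - 1)]
    push_cast
    rw [show d - (N + 1 - (k - 1)) = d - ((N : ℤ) + 1 + 1 - k) by ring,
      show d - k - (N + 1 - k) = d - ((N : ℤ) + 1 + 1 - k) - (k - 1) by ring]
    ring

theorem wordCount_symm (N : ℕ) (k d : ℤ) : wordCount N (N - k, d) = wordCount N (k, d) := by
  induction N generalizing k d with
  | zero => simp [wordCount_zero_apply]
  | succ N ih =>
    rw [wordCount_succ_apply, wordCount_succ_apply', ← ih k, ← ih (k - 1)]
    push_cast
    rw [show (N : ℤ) + 1 - k - 1 = N - k by ring, show (N : ℤ) + 1 - k = N - (k - 1) by ring]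

theorem sum_wordCount_succ (N : ℕ) (F : ℤ × ℤ → ℚ) :
    ((wordCount (N + 1)).sum fun p c => (c : ℚ) * F p) =
      (wordCount N).sum fun p c => (c : ℚ) * (F (p.1 + 1, p.2) + F (p.1, p.2 + p.1)) := by
  rw [wordCount, Finsupp.sum_add_index' (by simp) (by intros; push_cast; ring),
    Finsupp.sum_equivMapDomain, Finsupp.sum_equivMapDomain, ← Finsupp.sum_add]
  simp only [mul_add]
  rfl

/-- The moments of weighted degree at most four of the number of ones `k` (of degree one) and of
the number of inversions `d` (of degree two) of a uniformly random binary word. -/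
theorem sum_wordCount_polynomial (N : ℕ) (c₀ c₁ c₂ c₃ c₄ e₀ e₁ e₂ e₃ : ℚ) :
    ((wordCount N).sum fun p c => (c : ℚ) *
      (c₀ + c₁ * p.1 + c₂ * p.1 ^ 2 + c₃ * p.1 ^ 3 + c₄ * p.1 ^ 4
        + e₀ * p.2 + e₁ * p.1 * p.2 + e₂ * p.1 ^ 2 * p.2 + e₃ * p.2 ^ 2)) =
      2 ^ N * (c₀ + c₁ * (N / 2) + c₂ * (N / 4 + N ^ 2 / 4) + c₃ * (3 * N ^ 2 / 8 + N ^ 3 / 8)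
        + c₄ * (-N / 8 + 3 * N ^ 2 / 16 + 3 * N ^ 3 / 8 + N ^ 4 / 16)
        + e₀ * (-N / 8 + N ^ 2 / 8) + e₁ * (-N ^ 2 / 16 + N ^ 3 / 16)
        + e₂ * (N / 16 - 3 * N ^ 2 / 32 + N ^ 4 / 32)
        + e₃ * (-5 * N / 96 + 3 * N ^ 2 / 64 - N ^ 3 / 96 + N ^ 4 / 64)) := by
  induction N generalizing c₀ c₁ c₂ c₃ c₄ e₀ e₁ e₂ e₃ with
  | zero => simp [wordCount]
  | succ N ih =>
    rw [sum_wordCount_succ N fun p => c₀ + c₁ * p.1 + c₂ * p.1 ^ 2 + c₃ * p.1 ^ 3 + c₄ * p.1 ^ 4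
        + e₀ * p.2 + e₁ * p.1 * p.2 + e₂ * p.1 ^ 2 * p.2 + e₃ * p.2 ^ 2]
    have h := ih (2 * c₀ + c₁ + c₂ + c₃ + c₄) (2 * c₁ + 2 * c₂ + 3 * c₃ + 4 * c₄ + e₀)
      (2 * c₂ + 3 * c₃ + 6 * c₄ + e₁ + e₃) (2 * c₃ + 4 * c₄ + e₂) (2 * c₄)
      (2 * e₀ + e₁ + e₂) (2 * e₁ + 2 * e₂ + 2 * e₃) (2 * e₂) (2 * e₃)
    convert h using 1
    · congr! 3
      push_cast
      ring
    · push_cast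
      ring

theorem elemD0_apply (p : ℤ × ℤ) (x y : ℤ) :
    elemD0 p (x, y) =
      (if p.2 = y ∧ p.1 ≤ x ∧ x - p.1 ≤ 1 - 2 * p.1 + 2 * p.2 then 1 else 0)
      - (if p.2 = y ∧ 1 - 2 * p.1 + 2 * p.2 < x - p.1 ∧ x < p.1 then 1 else 0) := by
  have key (s : Finset ℤ) :
      (∑ i ∈ s, Finsupp.single (p.1 + i, p.2) (1 : ℤ)) (x, y) =
        if p.2 = y ∧ x - p.1 ∈ s then 1 else 0 := by
    rw [Finsupp.finsetSum_apply]
    simp only [Finsupp.single_apply, Prod.mk.injEq, ← eq_sub_iff_add_eq', ite_and,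
      Finset.sum_ite_eq']
    split_ifs <;> rfl
  rw [elemD0, Finsupp.sub_apply, key, key]
  simp only [Finset.mem_Icc]
  congr 2 <;> simp only [eq_iff_iff] <;> omega

theorem elemD1_apply (p : ℤ × ℤ) (x y : ℤ) :
    elemD1 p (x, y) =
      (if p.1 = x ∧ p.2 ≤ y ∧ y - p.2 ≤ 2 * p.1 - 2 * p.2 then 1 else 0)
      - (if p.1 = x ∧ 2 * p.1 - 2 * p.2 < y - p.2 ∧ y < p.2 then 1 else 0) := by
  have key (s : Finset ℤ) :
      (∑ i ∈ s, Finsupp.single (p.1, p.2 + i) (1 : ℤ)) (x, y) =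
        if p.1 = x ∧ y - p.2 ∈ s then 1 else 0 := by
    rw [Finsupp.finsetSum_apply]
    simp only [Finsupp.single_apply, Prod.mk.injEq, ← eq_sub_iff_add_eq', ite_and]
    split_ifs <;> simp [*]
  rw [elemD1, Finsupp.sub_apply, key, key]
  simp only [Finset.mem_Icc]
  congr 2 <;> simp only [eq_iff_iff] <;> omega

theorem demD0_add (μ ν : (ℤ × ℤ) →₀ ℤ) : demD0 (μ + ν) = demD0 μ + demD0 ν :=
  Finsupp.sum_add_index' (by simp) (by intros; rw [add_smul])

theorem demD1_add (μ ν : (ℤ × ℤ) →₀ ℤ) : demD1 (μ + ν) = demD1 μ + demD1 ν :=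
  Finsupp.sum_add_index' (by simp) (by intros; rw [add_smul])

/-- The coefficients of `(1 - e^{-α₀}) D₀ μ = μ - e^{-α₀} s₀ μ`. -/
theorem demD0_apply_sub (μ : (ℤ × ℤ) →₀ ℤ) (a b : ℤ) :
    demD0 μ (a, b) - demD0 μ (a - 1, b) = μ (a, b) - μ (2 - a + 2 * b, b) := by
  induction μ using Finsupp.induction_linear with
  | zero => simp [demD0]
  | add μ ν hμ hν =>
    simp only [demD0_add, Finsupp.add_apply]
    linear_combination hμ + hν
  | single p c =>
    obtain ⟨x, y⟩ := p
    rw [demD0, Finsupp.sum_single_index (by simp)]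
    simp only [Finsupp.smul_apply, smul_eq_mul, elemD0_apply, Finsupp.single_apply, Prod.mk.injEq]
    split_ifs <;> omega

/-- The coefficients of `(1 - e^{-α₁}) D₁ μ = μ - e^{-α₁} s₁ μ`. -/
theorem demD1_apply_sub (μ : (ℤ × ℤ) →₀ ℤ) (a b : ℤ) :
    demD1 μ (a, b) - demD1 μ (a, b - 1) = μ (a, b) - μ (a, 2 * a - b + 1) := by
  induction μ using Finsupp.induction_linear with
  | zero => simp [demD1]
  | add μ ν hμ hν =>
    simp only [demD1_add, Finsupp.add_apply]
    linear_combination hμ + hν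
  | single p c =>
    obtain ⟨x, y⟩ := p
    rw [demD1, Finsupp.sum_single_index (by simp)]
    simp only [Finsupp.smul_apply, smul_eq_mul, elemD1_apply, Finsupp.single_apply, Prod.mk.injEq]
    split_ifs <;> omega

theorem Finsupp.eq_of_sub_shift_eq {α : Type*} (μ ν : α →₀ ℤ) (φ : ℤ → α)
    (hφ : Function.Injective φ)
    (h : ∀ a, μ (φ a) - μ (φ (a - 1)) = ν (φ a) - ν (φ (a - 1))) (a : ℤ) :
    μ (φ a) = ν (φ a) := by
  have hconst (n : ℕ) : (μ - ν) (φ (a - n)) = (μ - ν) (φ a) := by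
    induction n with
    | zero => simp
    | succ n ih =>
      rw [← ih]
      have := h (a - n)
      simp only [Finsupp.sub_apply]
      push_cast
      rw [show a - ((n : ℤ) + 1) = a - n - 1 by ring]
      linarith
  by_contra hne
  have hinj : Function.Injective fun n : ℕ => φ (a - n) := fun m n hmn => by
    have := hφ hmn
    omega
  refine Set.infinite_range_of_injective hinj ((μ - ν).support.finite_toSet.subset ?_)
  rintro _ ⟨n, rfl⟩
  simp only [Finset.mem_coe, Finsupp.mem_support_iff, hconst]
  simpa [sub_eq_zero] using hne

/-- The weight `Λ₀ - a·α₀ - b·α₁` with `b - a = k - c` and `a = (k - c)² + d`. -/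
def weightEquiv (c : ℤ) : ℤ × ℤ ≃ ℤ × ℤ where
  toFun p := ((p.1 - c) ^ 2 + p.2, (p.1 - c) ^ 2 + p.2 + (p.1 - c))
  invFun p := (p.2 - p.1 + c, p.1 - (p.2 - p.1) ^ 2)
  left_inv p := by ext <;> simp
  right_inv p := by ext <;> simp

theorem demD0_wordCount (m : ℕ) :
    demD0 (Finsupp.equivMapDomain (weightEquiv m) (wordCount (2 * m))) =
      Finsupp.equivMapDomain (weightEquiv (m + 1)) (wordCount (2 * m + 1)) := by
  ext ⟨a, b⟩
  refine Finsupp.eq_of_sub_shift_eq _ _ (fun x => (x, b)) (fun x y h => congrArg Prod.fst h)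
    (fun a => ?_) a
  rw [demD0_apply_sub]
  simp only [Finsupp.equivMapDomain_apply, weightEquiv, Equiv.coe_fn_symm_mk]
  rw [wordCount_succ_apply, wordCount_succ_apply',
    ← wordCount_symm (2 * m) (b - (2 - a + 2 * b) + m)]
  push_cast
  ring_nf

theorem demD1_wordCount (m : ℕ) :
    demD1 (Finsupp.equivMapDomain (weightEquiv (m + 1)) (wordCount (2 * m + 1))) =
      Finsupp.equivMapDomain (weightEquiv (m + 1)) (wordCount (2 * m + 1 + 1)) := by
  ext ⟨a, b⟩
  refine Finsupp.eq_of_sub_shift_eq _ _ (fun x => (a, x)) (fun x y h => congrArg Prod.snd h)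
    (fun b => ?_) b
  rw [demD1_apply_sub]
  simp only [Finsupp.equivMapDomain_apply, weightEquiv, Equiv.coe_fn_symm_mk]
  rw [wordCount_succ_apply' (2 * m + 1), wordCount_succ_apply (2 * m + 1),
    ← wordCount_symm (2 * m + 1) (2 * a - b + 1 - a + (m + 1))]
  push_cast
  ring_nf

theorem demMu_even_odd (m : ℕ) :
    demMu (2 * m) = Finsupp.equivMapDomain (weightEquiv m) (wordCount (2 * m)) ∧
    demMu (2 * m + 1) =
      Finsupp.equivMapDomain (weightEquiv (m + 1)) (wordCount (2 * m + 1)) := by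
  have step (m : ℕ)
      (h : demMu (2 * m) = Finsupp.equivMapDomain (weightEquiv m) (wordCount (2 * m))) :
      demMu (2 * m + 1) =
        Finsupp.equivMapDomain (weightEquiv (m + 1)) (wordCount (2 * m + 1)) := by
    rw [demMu, if_pos (even_two_mul m), h, demD0_wordCount]
  induction m with
  | zero =>
    have h : demMu (2 * 0) =
        Finsupp.equivMapDomain (weightEquiv (0 : ℕ)) (wordCount (2 * 0)) := by
      simp [demMu, wordCount, weightEquiv]
    exact ⟨h, step 0 h⟩
  | succ m ih =>
    have h : demMu (2 * (m + 1)) =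
        Finsupp.equivMapDomain (weightEquiv (m + 1 : ℕ)) (wordCount (2 * (m + 1))) := by
      rw [show 2 * (m + 1) = 2 * m + 1 + 1 by ring, demMu,
        if_neg (Nat.not_even_iff_odd.2 (odd_two_mul_add_one m)), ih.2, demD1_wordCount]
      push_cast
      rfl
    exact ⟨h, step (m + 1) h⟩

theorem expVal_weightEquiv (N : ℕ) (c : ℤ) (f : ℤ × ℤ → ℚ) :
    expVal (Finsupp.equivMapDomain (weightEquiv c) (wordCount N)) f =
      ((wordCount N).sum fun p n => (n : ℚ) * f (weightEquiv c p)) / 2 ^ N := by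
  have h := sum_wordCount_polynomial N 1 0 0 0 0 0 0 0 0
  simp only [zero_mul, add_zero, mul_one] at h
  rw [expVal, totalMass, Finsupp.sum_equivMapDomain, Finsupp.sum_equivMapDomain, h]

theorem expVal_weightEquiv_fst_sq (N : ℕ) (c : ℤ) :
    expVal (Finsupp.equivMapDomain (weightEquiv c) (wordCount N)) (fun p => (p.1 : ℚ) ^ 2) =
      c ^ 4 + -4 * c ^ 3 * (N / 2) + 6 * c ^ 2 * (N / 4 + N ^ 2 / 4)
        + -4 * c * (3 * N ^ 2 / 8 + N ^ 3 / 8)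
        + (-N / 8 + 3 * N ^ 2 / 16 + 3 * N ^ 3 / 8 + N ^ 4 / 16)
        + 2 * c ^ 2 * (-N / 8 + N ^ 2 / 8) + -4 * c * (-N ^ 2 / 16 + N ^ 3 / 16)
        + 2 * (N / 16 - 3 * N ^ 2 / 32 + N ^ 4 / 32)
        + (-5 * N / 96 + 3 * N ^ 2 / 64 - N ^ 3 / 96 + N ^ 4 / 64) := by
  have h := sum_wordCount_polynomial N (c ^ 4) (-4 * c ^ 3) (6 * c ^ 2) (-4 * c) 1
    (2 * c ^ 2) (-4 * c) 2 1
  rw [expVal_weightEquiv, div_eq_iff (by positivity)]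
  convert h using 1
  · congr! 3
    simp only [weightEquiv, Equiv.coe_fn_mk]
    push_cast
    ring
  · ring

theorem expVal_weightEquiv_snd_sq (N : ℕ) (c : ℤ) :
    expVal (Finsupp.equivMapDomain (weightEquiv c) (wordCount N)) (fun p => (p.2 : ℚ) ^ 2) =
      (c ^ 2 - c) ^ 2 + 2 * (c ^ 2 - c) * (1 - 2 * c) * (N / 2)
        + ((1 - 2 * c) ^ 2 + 2 * (c ^ 2 - c)) * (N / 4 + N ^ 2 / 4)
        + 2 * (1 - 2 * c) * (3 * N ^ 2 / 8 + N ^ 3 / 8)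
        + (-N / 8 + 3 * N ^ 2 / 16 + 3 * N ^ 3 / 8 + N ^ 4 / 16)
        + 2 * (c ^ 2 - c) * (-N / 8 + N ^ 2 / 8)
        + 2 * (1 - 2 * c) * (-N ^ 2 / 16 + N ^ 3 / 16)
        + 2 * (N / 16 - 3 * N ^ 2 / 32 + N ^ 4 / 32)
        + (-5 * N / 96 + 3 * N ^ 2 / 64 - N ^ 3 / 96 + N ^ 4 / 64) := by
  have h := sum_wordCount_polynomial N ((c ^ 2 - c) ^ 2) (2 * (c ^ 2 - c) * (1 - 2 * c))
    ((1 - 2 * c) ^ 2 + 2 * (c ^ 2 - c)) (2 * (1 - 2 * c)) 1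
    (2 * (c ^ 2 - c)) (2 * (1 - 2 * c)) 2 1
  rw [expVal_weightEquiv, div_eq_iff (by positivity)]
  convert h using 1
  · congr! 3
    simp only [weightEquiv, Equiv.coe_fn_mk]
    push_cast
    ring
  · ring

/-- Modified recurrence relations: for odd `N`,
`E_{μ_{N+1}}[a²] = E_{μ_N}[b²] + N(N+2)(N+3)/16`, and for even `N`,
`E_{μ_{N+1}}[b²] = E_{μ_N}[a²] + N(N+1)(N+2)/16`. -/
theorem modified_recurrence_relations (N : ℕ) :
    (Odd N →
      expVal (demMu (N + 1)) (fun p => (p.1 : ℚ) ^ 2) =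
        expVal (demMu N) (fun p => (p.2 : ℚ) ^ 2)
          + (N : ℚ) * ((N : ℚ) + 2) * ((N : ℚ) + 3) / 16) ∧
    (Even N →
      expVal (demMu (N + 1)) (fun p => (p.2 : ℚ) ^ 2) =
        expVal (demMu N) (fun p => (p.1 : ℚ) ^ 2)
          + (N : ℚ) * ((N : ℚ) + 1) * ((N : ℚ) + 2) / 16) := by
  constructor
  · rintro ⟨m, rfl⟩
    rw [show 2 * m + 1 + 1 = 2 * (m + 1) by ring, (demMu_even_odd (m + 1)).1,
      (demMu_even_odd m).2, expVal_weightEquiv_fst_sq, expVal_weightEquiv_snd_sq]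
    push_cast
    ring
  · rintro ⟨m, rfl⟩
    rw [← two_mul, (demMu_even_odd m).1, (demMu_even_odd m).2, expVal_weightEquiv_fst_sq,
      expVal_weightEquiv_snd_sq]
    push_cast
    ring
end
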